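/- The Sasano system B4(0, 0, 0, 0, 1/2) (i.e., with parameters α0=α1=α2=α3=0 and α4=1/2, which satisfy α0+α1+2α2+2α3+2α4=1) admits no rational solution. -/

import Mathlib

open Filter Topology Polynomial

noncomputable section

/-- The four equations of the Sasano system of type `B₄⁽¹⁾` at the point `t`. -/
def B4Eqs (a0 a1 a2 a3 a4 : ℂ) (x y z w : ℂ → ℂ) (t : ℂ) : Prop :=
  (t * deriv x t =
      2 * x t ^ 2 * y t - x t ^ 2 + (1 - 2*a2 - 2*a3 - 2*a4) * x t
        + 2 * a3 * z t + 2 * z t ^ 2 * w t + t) ∧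
  (t * deriv y t =
      -2 * x t * y t ^ 2 + 2 * x t * y t - (1 - 2*a2 - 2*a3 - 2*a4) * y t + a1) ∧
  (t * deriv z t =
      2 * z t ^ 2 * w t - z t ^ 2 + (1 - 2*a4) * z t + 2 * y t * z t ^ 2 + t) ∧
  (t * deriv w t =
      -2 * z t * w t ^ 2 + 2 * z t * w t - (1 - 2*a4) * w t
        - 2 * a3 * y t - 4 * y t * z t * w t + a3)

/-- A complex rational function: a quotient of two polynomials (with junk value `0`
at poles), regarded as a function on `ℂ`. -/
def IsRatFn (f : ℂ → ℂ) : Prop :=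
  ∃ p q : Polynomial ℂ, q ≠ 0 ∧ ∀ t : ℂ, f t = p.eval t / q.eval t

/-- A rational solution of the Sasano system `B₄⁽¹⁾`: a quadruple of rational functions
satisfying the four equations outside a finite set. -/
def IsRatSolB4 (a0 a1 a2 a3 a4 : ℂ) (x y z w : ℂ → ℂ) : Prop :=
  IsRatFn x ∧ IsRatFn y ∧ IsRatFn z ∧ IsRatFn w ∧
    ∃ S : Set ℂ, S.Finite ∧ ∀ t ∉ S, B4Eqs a0 a1 a2 a3 a4 x y z w t

/-! ### Rational functions up to a finite set -/

def RatAE (f : ℂ → ℂ) : Prop :=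
  ∃ p q : ℂ[X], q ≠ 0 ∧ f =ᶠ[cofinite] fun t => p.eval t / q.eval t

lemma ev_poly_ne {q : ℂ[X]} (hq : q ≠ 0) : ∀ᶠ t in cofinite, q.eval t ≠ 0 := by
  have h := (q.roots.toFinset.finite_toSet).eventually_cofinite_notMem
  filter_upwards [h] with t ht h0
  apply ht
  simp [hq, h0]

lemma ev_ne (c : ℂ) : ∀ᶠ t in cofinite, t ≠ c := by
  have h := (Set.finite_singleton c).eventually_cofinite_notMem
  filter_upwards [h] with t ht h0
  exact ht h0

lemma RatAE.of_isRatFn {f : ℂ → ℂ} (h : IsRatFn f) : RatAE f := by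
  obtain ⟨p, q, hq, h⟩ := h
  exact ⟨p, q, hq, Eventually.of_forall h⟩

lemma RatAE.const (a : ℂ) : RatAE (fun _ => a) :=
  ⟨C a, 1, one_ne_zero, by simp [EventuallyEq]⟩

lemma RatAE.id : RatAE (fun t => t) :=
  ⟨X, 1, one_ne_zero, by simp [EventuallyEq]⟩

lemma RatAE.add {f g : ℂ → ℂ} (hf : RatAE f) (hg : RatAE g) : RatAE (fun t => f t + g t) := by
  obtain ⟨p, q, hq, h⟩ := hf
  obtain ⟨p', q', hq', h'⟩ := hg
  refine ⟨p * q' + p' * q, q * q', mul_ne_zero hq hq', ?_⟩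
  filter_upwards [h, h', ev_poly_ne hq, ev_poly_ne hq'] with t h1 h2 h3 h4
  simp only [eval_add, eval_mul]
  rw [h1, h2]
  field_simp

lemma RatAE.mul {f g : ℂ → ℂ} (hf : RatAE f) (hg : RatAE g) : RatAE (fun t => f t * g t) := by
  obtain ⟨p, q, hq, h⟩ := hf
  obtain ⟨p', q', hq', h'⟩ := hg
  refine ⟨p * p', q * q', mul_ne_zero hq hq', ?_⟩
  filter_upwards [h, h'] with t h1 h2
  simp only [eval_mul]
  rw [h1, h2, div_mul_div_comm]

lemma RatAE.sub {f g : ℂ → ℂ} (hf : RatAE f) (hg : RatAE g) : RatAE (fun t => f t - g t) := by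
  have := hf.add ((RatAE.const (-1)).mul hg)
  simpa [sub_eq_add_neg] using this

lemma cof_nhds {P : ℂ → Prop} (h : ∀ᶠ t in cofinite, P t) :
    ∀ᶠ t in cofinite, ∀ᶠ s in 𝓝 t, P s := by
  have h1 : {t | P t}ᶜ.Finite := h
  have h2 : IsOpen {t | P t} := by
    have := h1.isClosed.isOpen_compl
    rwa [compl_compl] at this
  filter_upwards [h] with t ht
  exact h2.mem_nhds ht

lemma deriv_congr_cof {f g : ℂ → ℂ} (h : f =ᶠ[cofinite] g) : deriv f =ᶠ[cofinite] deriv g := by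
  filter_upwards [cof_nhds h] with t ht
  exact Filter.EventuallyEq.deriv_eq ht

lemma RatAE.diff {f : ℂ → ℂ} (hf : RatAE f) : ∀ᶠ t in cofinite, DifferentiableAt ℂ f t := by
  obtain ⟨p, q, hq, h⟩ := hf
  filter_upwards [cof_nhds h, ev_poly_ne hq] with t ht hqt
  have : DifferentiableAt ℂ (fun t => p.eval t / q.eval t) t :=
    p.differentiable.differentiableAt.div q.differentiable.differentiableAt hqt
  exact this.congr_of_eventuallyEq ht

lemma nhdsNE_le_cof (c : ℂ) : 𝓝[≠] c ≤ cofinite := by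
  intro s hs
  have h1 : sᶜ.Finite := hs
  have h2 : IsOpen (sᶜ \ {c})ᶜ := (h1.subset Set.sdiff_subset).isClosed.isOpen_compl
  have h3 : (sᶜ \ {c})ᶜ ∈ 𝓝 c := h2.mem_nhds (by simp)
  rw [mem_nhdsWithin_iff_exists_mem_nhds_inter]
  refine ⟨_, h3, ?_⟩
  rintro t ⟨ht, htc⟩
  by_contra h
  exact ht ⟨h, htc⟩

lemma cob_le_cof : Bornology.cobounded ℂ ≤ cofinite := Bornology.le_cofinite ℂ

lemma tl {l : Filter ℂ} {f g : ℂ → ℂ} {a b : ℂ} (h : Tendsto f l (𝓝 a)) (he : f =ᶠ[l] g)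
    (hab : a = b) : Tendsto g l (𝓝 b) := hab ▸ h.congr' he

lemma td {l : Filter ℂ} {f g : ℂ → ℂ} {a b : ℂ} (hf : Tendsto f l (𝓝 a)) (hg : Tendsto g l (𝓝 b))
    (hb : b ≠ 0) : Tendsto (fun t => f t / g t) l (𝓝 (a / b)) := hf.div hg hb

/-- Expansion data of a place. -/
structure Place (l : Filter ℂ) (s m : ℂ → ℂ) (ε : ℂ) : Prop where
  ne : l.NeBot
  le : l ≤ cofinite
  s0 : Tendsto s l (𝓝 0)
  sne : ∀ᶠ t in l, s t ≠ 0
  eps : ε ^ 2 = 1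
  ex : ∀ f, RatAE f → ¬ (f =ᶠ[cofinite] fun _ => 0) → ∃ n : ℤ, ∃ a : ℂ, a ≠ 0 ∧
    Tendsto (fun t => f t / s t ^ n) l (𝓝 a) ∧
    Tendsto (fun t => m t * deriv f t / f t) l (𝓝 (ε * n))

/-- It suffices to have expansions of polynomials. -/
lemma place_ex {l : Filter ℂ} {s m : ℂ → ℂ} {ε : ℂ} (le : l ≤ cofinite)
    (sne : ∀ᶠ t in l, s t ≠ 0)
    (H : ∀ f : ℂ[X], f ≠ 0 → ∃ n : ℤ, ∃ a : ℂ, a ≠ 0 ∧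
      Tendsto (fun t => f.eval t / s t ^ n) l (𝓝 a) ∧
      Tendsto (fun t => m t * f.derivative.eval t / f.eval t) l (𝓝 (ε * n)))
    (f : ℂ → ℂ) (hf : RatAE f) (hf0 : ¬ (f =ᶠ[cofinite] fun _ => 0)) : ∃ n : ℤ, ∃ a : ℂ, a ≠ 0 ∧
    Tendsto (fun t => f t / s t ^ n) l (𝓝 a) ∧
    Tendsto (fun t => m t * deriv f t / f t) l (𝓝 (ε * n)) := by
  obtain ⟨p, q, hq, h⟩ := hf
  have hp : p ≠ 0 := by
    rintro rfl
    apply hf0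
    filter_upwards [h] with t ht
    simp [ht]
  obtain ⟨n, a, ha, h1, h2⟩ := H p hp
  obtain ⟨k, b, hb, h3, h4⟩ := H q hq
  refine ⟨n - k, a / b, div_ne_zero ha hb, ?_, ?_⟩
  · refine tl (td h1 h3 hb) ?_ rfl
    filter_upwards [sne, le h, le (ev_poly_ne hq)] with t h5 h6 h7
    rw [h6, zpow_sub₀ h5]
    have := zpow_ne_zero n h5
    have := zpow_ne_zero k h5
    field_simp
  · refine tl (h2.sub h4) ?_ (by push_cast; ring)
    filter_upwards [le h, le (deriv_congr_cof h), le (ev_poly_ne hq), le (ev_poly_ne hp)]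
      with t h6 h7 h8 h9
    rw [h7, h6]
    have := ((p.hasDerivAt t).div (q.hasDerivAt t) h8).deriv
    have e : deriv (fun t => p.eval t / q.eval t) t =
      (p.derivative.eval t * q.eval t - p.eval t * q.derivative.eval t) / q.eval t ^ 2 := this
    rw [e]
    field_simp

lemma place_fin (c : ℂ) : Place (𝓝[≠] c) (fun t => t - c) (fun t => t - c) 1 := by
  have sne : ∀ᶠ t in 𝓝[≠] c, t - c ≠ 0 := by
    filter_upwards [self_mem_nhdsWithin] with t ht
    exact sub_ne_zero.mpr ht
  have cont : ∀ f : ℂ[X], Tendsto (fun t => f.eval t) (𝓝[≠] c) (𝓝 (f.eval c)) := fun f =>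
    (f.continuous.tendsto c).mono_left nhdsWithin_le_nhds
  have s0 : Tendsto (fun t : ℂ => t - c) (𝓝[≠] c) (𝓝 0) := by
    have := cont (X - C c)
    simp only [eval_sub, eval_X, eval_C, sub_self] at this
    exact this
  refine ⟨inferInstance, nhdsNE_le_cof c, s0, sne, by norm_num,
    place_ex (nhdsNE_le_cof c) sne ?_⟩
  intro f hf
  obtain ⟨g, hg, hgc⟩ := f.exists_eq_pow_rootMultiplicity_mul_and_not_dvd hf c
  set n := f.rootMultiplicity c
  have hgc' : g.eval c ≠ 0 := fun h => hgc (dvd_iff_isRoot.mpr h)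
  have gne : ∀ᶠ t in 𝓝[≠] c, g.eval t ≠ 0 := (cont g).eventually_ne hgc'
  refine ⟨n, g.eval c, hgc', tl (cont g) ?_ rfl, ?_⟩
  · filter_upwards [sne] with t ht
    rw [hg]
    simp only [eval_mul, eval_pow, eval_sub, eval_X, eval_C, zpow_natCast]
    field_simp
  · have := ((td (s0.mul (cont g.derivative)) (cont g) hgc').const_add (n : ℂ))
    refine tl this ?_ (by simp)
    filter_upwards [sne, gne] with t ht hgt
    rw [hg]
    simp only [derivative_mul, derivative_X_sub_C_pow, eval_mul, eval_pow, eval_sub, eval_X, eval_C,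
      eval_add]
    rcases Nat.eq_zero_or_pos n with h0 | h0
    · rw [h0]; simp
    · obtain ⟨k, hk⟩ : ∃ k, n = k + 1 := ⟨n - 1, by omega⟩
      rw [hk]
      simp only [Nat.add_sub_cancel, pow_succ]
      field_simp

lemma inv_cob : Tendsto (fun t : ℂ => t⁻¹) (Bornology.cobounded ℂ) (𝓝 0) :=
  tendsto_inv₀_cobounded

lemma poly_cob (f : ℂ[X]) (n : ℕ) (h : f.natDegree ≤ n) :
    Tendsto (fun t => f.eval t / t ^ n) (Bornology.cobounded ℂ) (𝓝 (f.coeff n)) := by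
  have h1 : Tendsto (fun t : ℂ => (f.reflect n).eval t⁻¹) (Bornology.cobounded ℂ)
      (𝓝 (f.coeff n)) := by
    have := ((f.reflect n).continuous.tendsto 0).comp inv_cob
    refine tl this (Eventually.of_forall fun t => rfl) ?_
    rw [← coeff_zero_eq_eval_zero, coeff_reflect]
    simp
  refine tl h1 ?_ rfl
  filter_upwards [cob_le_cof (ev_ne 0)] with t ht
  have : Invertible t := invertibleOfNonzero ht
  have e := eval₂_reflect_mul_pow (RingHom.id ℂ) t n f h
  rw [invOf_eq_inv] at e
  have e' : (f.reflect n).eval t⁻¹ * t ^ n = f.eval t := e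
  rw [← e']
  field_simp

lemma place_inf : Place (Bornology.cobounded ℂ) (fun t => t⁻¹) (fun t => t) (-1) := by
  have sne : ∀ᶠ t : ℂ in Bornology.cobounded ℂ, t⁻¹ ≠ 0 := by
    filter_upwards [cob_le_cof (ev_ne 0)] with t ht
    exact inv_ne_zero ht
  refine ⟨inferInstance, cob_le_cof, inv_cob, sne, by norm_num, place_ex cob_le_cof sne ?_⟩
  intro f hf
  set n := f.natDegree with hn
  have hl : f.coeff n ≠ 0 := by
    rw [hn, coeff_natDegree]; exact leadingCoeff_ne_zero.mpr hf
  have h1 := poly_cob f n le_rfl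
  refine ⟨-n, f.coeff n, hl, tl h1 ?_ rfl, ?_⟩
  · refine Eventually.of_forall fun t => ?_
    simp
  · have h2 := poly_cob (X * f.derivative) n (by
      by_cases h0 : n = 0
      · have : f.derivative = 0 := by
          rw [eq_C_of_natDegree_eq_zero h0]; simp
        simp [this]
      · have := natDegree_derivative_lt (p := f) h0
        have := natDegree_mul_le (p := (X : ℂ[X])) (q := f.derivative)
        rw [natDegree_X] at this
        omega)
    refine tl (td h2 h1 hl) ?_ ?_
    · filter_upwards [cob_le_cof (ev_ne 0)] with t ht
      have := pow_ne_zero n ht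
      simp only [eval_mul, eval_X]
      rw [div_div_div_cancel_right₀ this]
    · have : (X * f.derivative).coeff n = n * f.coeff n := by
        rcases n with _ | k
        · simp
        · rw [coeff_X_mul, coeff_derivative]; push_cast; ring
      rw [this]
      field_simp
      simp

section places
variable {l : Filter ℂ} {s m : ℂ → ℂ} {ε : ℂ}

lemma Place.spow (h : Place l s m ε) {n : ℤ} (hn : 0 < n) :
    Tendsto (fun t => s t ^ n) l (𝓝 0) := by
  obtain ⟨k, rfl⟩ : ∃ k : ℕ, n = k := ⟨n.toNat, by omega⟩
  have := h.s0.pow k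
  rw [zero_pow (by omega)] at this
  simpa using this

lemma Place.evne (_h : Place l s m ε) {f : ℂ → ℂ} {n : ℤ} {a : ℂ} (ha : a ≠ 0)
    (hf : Tendsto (fun t => f t / s t ^ n) l (𝓝 a)) : ∀ᶠ t in l, f t ≠ 0 := by
  filter_upwards [hf.eventually_ne ha] with t ht h0
  simp [h0] at ht

lemma Place.shift (h : Place l s m ε) {f : ℂ → ℂ} {n : ℤ} {a : ℂ} (k : ℤ) (hk : k < n)
    (hf : Tendsto (fun t => f t / s t ^ n) l (𝓝 a)) :
    Tendsto (fun t => f t / s t ^ k) l (𝓝 0) := by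
  refine tl (hf.mul (h.spow (n := n - k) (by omega))) ?_ (by simp)
  filter_upwards [h.sne] with t ht
  rw [zpow_sub₀ ht]
  have := zpow_ne_zero n ht
  have := zpow_ne_zero k ht
  field_simp

lemma Place.lim0 (h : Place l s m ε) {f : ℂ → ℂ} {n : ℤ} {a : ℂ} (hn : 0 < n)
    (hf : Tendsto (fun t => f t / s t ^ n) l (𝓝 a)) : Tendsto f l (𝓝 0) := by
  simpa using h.shift 0 hn hf

lemma Place.inv0 (h : Place l s m ε) {f : ℂ → ℂ} {n : ℤ} {a : ℂ} (ha : a ≠ 0) (hn : n < 0)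
    (hf : Tendsto (fun t => f t / s t ^ n) l (𝓝 a)) : Tendsto (fun t => 1 / f t) l (𝓝 0) := by
  refine tl (td (h.spow (n := -n) (by omega)) hf ha) ?_ (by simp)
  filter_upwards [h.sne, h.evne ha hf] with t ht hft
  rw [zpow_neg]
  have := zpow_ne_zero n ht
  field_simp

/-- a function with infinite limit has no finite limit -/
lemma Place.noinv (h : Place l s m ε) {f : ℂ → ℂ} {a : ℂ}
    (hf : Tendsto (fun t => 1 / f t) l (𝓝 0)) (hne : ∀ᶠ t in l, f t ≠ 0)
    (hf' : Tendsto f l (𝓝 a)) : False := by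
  have := h.ne
  have h1 : Tendsto (fun _ : ℂ => (1 : ℂ)) l (𝓝 0) := by
    refine tl (hf.mul hf') ?_ (by simp)
    filter_upwards [hne] with t ht
    field_simp
  exact one_ne_zero (tendsto_nhds_unique tendsto_const_nhds h1)

/-- order comparison -/
lemma Place.le_ord (h : Place l s m ε) {f : ℂ → ℂ} {n k : ℤ} {a b : ℂ} (ha : a ≠ 0)
    (hf : Tendsto (fun t => f t / s t ^ n) l (𝓝 a))
    (hf' : Tendsto (fun t => f t / s t ^ k) l (𝓝 b)) : k ≤ n := by
  by_contra hlt
  have := h.ne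
  exact ha (tendsto_nhds_unique hf (h.shift n (by omega) hf'))

lemma Place.uniq (h : Place l s m ε) {f : ℂ → ℂ} {a b : ℂ} (h1 : Tendsto f l (𝓝 a))
    (h2 : Tendsto f l (𝓝 b)) : a = b := by
  have := h.ne
  exact tendsto_nhds_unique h1 h2

/-- Either zero, or a pole, or finite with derivative term tending to zero. -/
lemma Place.tri (h : Place l s m ε) {p : ℂ → ℂ} (hp : RatAE p) :
    (∃ k : ℤ, 0 < k ∧ ∃ a : ℂ, a ≠ 0 ∧ Tendsto (fun t => p t / s t ^ (-k)) l (𝓝 a) ∧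
      Tendsto (fun t => m t * deriv p t / p t) l (𝓝 (ε * (-k : ℤ)))) ∨
    (∃ p0 : ℂ, Tendsto p l (𝓝 p0) ∧ Tendsto (fun t => m t * deriv p t) l (𝓝 0)) := by
  by_cases h0 : p =ᶠ[cofinite] fun _ => 0
  · right
    refine ⟨0, tl tendsto_const_nhds (show p =ᶠ[l] _ from h.le h0).symm rfl, tl tendsto_const_nhds ?_ rfl⟩
    filter_upwards [h.le (deriv_congr_cof h0)] with t ht
    simp [ht]
  obtain ⟨n, a, ha, h1, h2⟩ := h.ex p hp h0
  rcases lt_trichotomy n 0 with hn | hn | hn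
  · left
    exact ⟨-n, by omega, a, ha, by simpa using h1, by simpa using h2⟩
  · right
    subst hn
    simp only [zpow_zero, div_one] at h1
    refine ⟨a, h1, tl (h2.mul h1) ?_ (by simp)⟩
    filter_upwards [h1.eventually_ne ha] with t ht
    field_simp
  · right
    refine ⟨0, h.lim0 hn h1, tl (h2.mul (h.lim0 hn h1)) ?_ (by simp)⟩
    filter_upwards [h.evne ha h1] with t ht
    field_simp

lemma Place.riccati (h : Place l s m ε) {p X : ℂ → ℂ} (hp : RatAE p)
    (hp1 : ¬ (p =ᶠ[cofinite] fun _ => 1)) (hp2 : ¬ (p =ᶠ[cofinite] fun _ => -1))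
    (he : ∀ᶠ t in l, m t * deriv p t = X t * (1 - p t ^ 2)) :
    (∃ k : ℤ, 0 < k ∧ ∃ a : ℂ, a ≠ 0 ∧ Tendsto (fun t => p t / s t ^ (-k)) l (𝓝 a) ∧
      Tendsto (fun t => X t * p t) l (𝓝 (ε * k)) ∧ Tendsto X l (𝓝 0)) ∨
    (∃ p0 x0 : ℂ, Tendsto p l (𝓝 p0) ∧ Tendsto X l (𝓝 x0) ∧ x0 * (1 - p0 ^ 2) = 0) := by
  rcases h.tri hp with ⟨k, hk, a, ha, h1, h2⟩ | ⟨p0, h1, h2⟩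
  · left
    have hi := h.inv0 ha (by omega) h1
    have hXp : Tendsto (fun t => X t * p t) l (𝓝 (ε * k)) := by
      have h3 := (hi.mul hi).sub_const 1
      refine tl (td h2 h3 (by simp)) ?_ (by push_cast; ring)
      filter_upwards [he, h.evne ha h1, h3.eventually_ne (b₂ := 0) (by simp)] with t ht hpt h4
      rw [ht]
      rw [div_eq_iff h4]
      field_simp
    refine ⟨k, hk, a, ha, h1, hXp, tl (hXp.mul hi) ?_ (by simp)⟩
    filter_upwards [h.evne ha h1] with t ht
    field_simp
  · right
    by_cases hq1 : p0 = 1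
    · subst hq1
      obtain ⟨n, a, ha, h3, h4⟩ := h.ex (fun t => p t - 1) (hp.sub (RatAE.const 1)) (by
        intro h0; apply hp1; filter_upwards [h0] with t ht; exact sub_eq_zero.mp ht)
      refine ⟨1, -(ε * n) / 2, h1, ?_, by norm_num⟩
      have h5 := h1.const_add 1
      refine tl (td h4.neg h5 (by norm_num)) ?_ (by norm_num)
      filter_upwards [he, h.evne ha h3, h5.eventually_ne (b₂ := 0) (by norm_num)] with t ht hpt h6
      rw [deriv_sub_const, ht, div_eq_iff h6]
      field_simp
      ring
    by_cases hq2 : p0 = -1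
    · subst hq2
      obtain ⟨n, a, ha, h3, h4⟩ := h.ex (fun t => p t + 1) (hp.add (RatAE.const 1)) (by
        intro h0; apply hp2; filter_upwards [h0] with t ht; exact eq_neg_of_add_eq_zero_left ht)
      refine ⟨-1, (ε * n) / 2, h1, ?_, by norm_num⟩
      have h5 := h1.const_sub 1
      refine tl (td h4 h5 (by norm_num)) ?_ (by norm_num)
      filter_upwards [he, h.evne ha h3, h5.eventually_ne (b₂ := 0) (by norm_num)] with t ht hpt h6
      rw [deriv_add_const, ht, div_eq_iff h6]
      field_simp
      ring
    have hq : 1 - p0 ^ 2 ≠ 0 := by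
      intro h0
      have : (p0 - 1) * (p0 + 1) = 0 := by linear_combination -h0
      rcases mul_eq_zero.mp this with h3 | h3
      · exact hq1 (sub_eq_zero.mp h3)
      · exact hq2 (eq_neg_of_add_eq_zero_left h3)
    refine ⟨p0, 0, h1, ?_, by simp⟩
    have h5 := (h1.pow 2).const_sub 1
    refine tl (td h2 h5 hq) ?_ (by simp)
    filter_upwards [he, h5.eventually_ne hq] with t ht h6
    rw [ht]
    field_simp

lemma Place.riccati_fin (h : Place l s m ε) {p X : ℂ → ℂ} (hp : RatAE p)
    (hp1 : ¬ (p =ᶠ[cofinite] fun _ => 1)) (hp2 : ¬ (p =ᶠ[cofinite] fun _ => -1))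
    (he : ∀ᶠ t in l, m t * deriv p t = X t * (1 - p t ^ 2)) :
    ∃ x0 y0, Tendsto X l (𝓝 x0) ∧ Tendsto (fun t => X t * p t) l (𝓝 y0) := by
  rcases h.riccati hp hp1 hp2 he with ⟨k, -, a, -, -, h2, h3⟩ | ⟨p0, x0, h2, h3, -⟩
  · exact ⟨_, _, h3, h2⟩
  · exact ⟨_, _, h3, h3.mul h2⟩

end places

/-- The transformed system. -/
structure Sol (x p z q : ℂ → ℂ) : Prop where
  rx : RatAE x
  rp : RatAE p
  rz : RatAE z
  rq : RatAE q
  ex : ∀ᶠ t in cofinite, t * deriv x t = (x t ^ 2 - z t ^ 2) * p t + z t ^ 2 * q t + t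
  ep : ∀ᶠ t in cofinite, t * deriv p t = x t * (1 - p t ^ 2)
  ez : ∀ᶠ t in cofinite, t * deriv z t = z t ^ 2 * q t + t
  eq : ∀ᶠ t in cofinite, t * deriv q t = (x t - z t) * (1 - p t ^ 2) + z t * (1 - q t ^ 2)

section sol
variable {x p z q : ℂ → ℂ}

lemma Sol.z_ne (h : Sol x p z q) : ¬ (z =ᶠ[cofinite] fun _ => 0) := by
  intro h0
  have : ∀ᶠ t : ℂ in cofinite, False := by
    filter_upwards [h.ez, h0, deriv_congr_cof h0, ev_ne 0] with t h1 h2 h3 h4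
    rw [h2, h3] at h1
    simp at h1
    exact h4 h1.symm
  simpa using this.exists

lemma Sol.ew (h : Sol x p z q) : ∀ᶠ t in cofinite,
    t * deriv (fun t => q t - p t) t = -(z t * (q t + p t)) * (q t - p t) := by
  filter_upwards [h.ep, h.eq, h.rq.diff, h.rp.diff] with t h1 h2 h3 h4
  rw [deriv_fun_sub h3 h4, mul_sub, h1, h2]
  ring

lemma Sol.eu (h : Sol x p z q) : ∀ᶠ t in cofinite,
    t * deriv (fun t => x t - z t) t = (x t + z t) * p t * (x t - z t) := by
  filter_upwards [h.ex, h.ez, h.rx.diff, h.rz.diff] with t h1 h2 h3 h4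
  rw [deriv_fun_sub h3 h4, mul_sub, h1, h2]
  ring

def KK (x p z q : ℂ → ℂ) (t : ℂ) : ℂ :=
  ((x t ^ 2 - z t ^ 2) * (p t ^ 2 - 1) + z t ^ 2 * (q t ^ 2 - 1)) / 4 + t * (q t + 1) / 2

lemma Sol.eK (h : Sol x p z q) : ∀ᶠ t in cofinite, deriv (KK x p z q) t = (q t + 1) / 2 := by
  filter_upwards [h.ex, h.ez, h.ep, h.eq, h.rx.diff, h.rz.diff, h.rp.diff, h.rq.diff, ev_ne 0]
    with t h1 h2 h3 h4 d1 d2 d3 d4 ht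
  have e1 := d1.hasDerivAt
  have e2 := d2.hasDerivAt
  have e3 := d3.hasDerivAt
  have e4 := d4.hasDerivAt
  have := ((((e1.fun_pow 2).fun_sub (e2.fun_pow 2)).fun_mul ((e3.fun_pow 2).sub_const 1)).fun_add
    ((e2.fun_pow 2).fun_mul ((e4.fun_pow 2).sub_const 1))).div_const 4 |>.fun_add
    (((hasDerivAt_id' t).fun_mul (e4.add_const 1)).div_const 2)
  have e := this.deriv
  have e' : deriv (KK x p z q) t = _ := e
  rw [e']
  apply mul_left_cancel₀ ht
  push_cast
  simp only [pow_one]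
  linear_combination (2 * x t * (p t ^ 2 - 1) / 4) * h1 + (2 * z t * (q t ^ 2 - 1) / 4
    - 2 * z t * (p t ^ 2 - 1) / 4) * h2
    + ((x t ^ 2 - z t ^ 2) * 2 * p t / 4) * h3 + (z t ^ 2 * 2 * q t / 4 + t / 2) * h4

lemma Sol.rK (h : Sol x p z q) : RatAE (KK x p z q) := by
  have h1 := h.rx.mul h.rx
  have h2 := h.rz.mul h.rz
  have h3 := (h.rp.mul h.rp).sub (RatAE.const 1)
  have h4 := (h.rq.mul h.rq).sub (RatAE.const 1)
  have h5 := ((RatAE.const (1/4)).mul (((h1.sub h2).mul h3).add (h2.mul h4))).add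
    ((RatAE.const (1/2)).mul (RatAE.id.mul (h.rq.add (RatAE.const 1))))
  convert h5 using 1
  funext t
  simp only [KK]
  ring

end sol

section inf
variable {x p z q : ℂ → ℂ}

lemma no_t_lim {a : ℂ} (h : Tendsto (fun t : ℂ => t) (Bornology.cobounded ℂ) (𝓝 a)) : False := by
  refine place_inf.noinv (f := fun t => t) ?_ (cob_le_cof (ev_ne 0)) h
  simpa using inv_cob

lemma no_sol_sub (rz : RatAE z) (rq : RatAE q)
    (ez : ∀ᶠ t in cofinite, t * deriv z t = z t ^ 2 * q t + t)
    (eq : ∀ᶠ t in cofinite, t * deriv q t = z t * (1 - q t ^ 2)) : False := by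
  have P := place_inf
  have key : ∀ z0 y0 : ℂ, Tendsto z (Bornology.cobounded ℂ) (𝓝 z0) →
      Tendsto (fun t => z t * q t) (Bornology.cobounded ℂ) (𝓝 y0) → False := by
    intro z0 y0 h1 h2
    rcases P.tri rz with ⟨k, hk, a, ha, h3, -⟩ | ⟨p0, -, h3⟩
    · exact P.noinv (P.inv0 ha (by omega) h3) (P.evne ha h3) h1
    · refine no_t_lim (tl (h3.sub (h1.mul h2)) ?_ rfl)
      filter_upwards [cob_le_cof ez] with t ht
      rw [ht]; ring
  have key2 : ∀ δ : ℂ, δ ≠ 0 → ¬ (q =ᶠ[cofinite] fun _ => δ) := by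
    intro δ hδ h0
    rcases P.tri rz with ⟨k, hk, a, ha, h3, h4⟩ | ⟨p0, h3, -⟩
    · have hi := P.inv0 ha (by omega) h3
      have h5 := td (P.spow (n := 2 * k - 1) (by omega)) (h3.mul h3) (mul_ne_zero ha ha)
      have h6 := (h4.mul hi).sub h5
      have h7 : Tendsto (fun _ : ℂ => δ) (Bornology.cobounded ℂ) (𝓝 0) := by
        refine tl h6 ?_ (by simp)
        filter_upwards [cob_le_cof ez, cob_le_cof h0, P.evne ha h3, cob_le_cof (ev_ne 0)]
          with t h8 h9 h10 h11
        rw [h8, h9, show 2 * k - 1 = k + k - 1 by ring, zpow_sub₀ (inv_ne_zero h11),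
          zpow_add₀ (inv_ne_zero h11), zpow_neg]
        have := zpow_ne_zero k (inv_ne_zero h11)
        simp only [zpow_one]
        field_simp
        ring
      exact hδ (P.uniq tendsto_const_nhds h7)
    · refine key p0 (p0 * δ) h3 (tl (h3.mul_const δ) ?_ rfl)
      filter_upwards [cob_le_cof h0] with t ht
      rw [ht]
  obtain ⟨z0, y0, h1, h2⟩ := P.riccati_fin rq (key2 1 one_ne_zero)
    (key2 (-1) (by norm_num)) (cob_le_cof eq)
  exact key z0 y0 h1 h2

lemma Sol.p_ne (h : Sol x p z q) (δ : ℂ) (hδ : δ ^ 2 = 1) : ¬ (p =ᶠ[cofinite] fun _ => δ) := by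
  intro h0
  refine no_sol_sub h.rz h.rq h.ez ?_
  filter_upwards [h.eq, h0] with t h1 h2
  rw [h1, h2, hδ]
  ring

lemma Sol.at_inf (h : Sol x p z q) :
    ¬ (p =ᶠ[cofinite] fun _ => 0) ∧ ¬ ((fun t => q t - p t) =ᶠ[cofinite] fun _ => 0) ∧
    ¬ ((fun t => x t - z t) =ᶠ[cofinite] fun _ => 0) ∧
    Tendsto (fun t => KK x p z q t - t / 2) (Bornology.cobounded ℂ) (𝓝 (-1/4)) := by
  have P := place_inf
  set l := Bornology.cobounded ℂ with hl
  have hric := P.riccati h.rp (h.p_ne 1 (by norm_num)) (h.p_ne (-1) (by norm_num))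
    (cob_le_cof h.ep)
  obtain ⟨x0, y0, hx, hxp⟩ := P.riccati_fin h.rp (h.p_ne 1 (by norm_num))
    (h.p_ne (-1) (by norm_num)) (cob_le_cof h.ep)
  have hx' : Tendsto (fun t => t * deriv x t) l (𝓝 0) := by
    rcases P.tri h.rx with ⟨k, hk, a, ha, h3, h4⟩ | ⟨p0, -, h3⟩
    · exact (P.noinv (P.inv0 ha (by omega) h3) (P.evne ha h3) hx).elim
    · exact h3
  have t0 : ∀ᶠ t : ℂ in l, t ≠ 0 := cob_le_cof (ev_ne 0)
  have A : Tendsto (fun t => z t ^ 2 * (q t - p t) + t) l (𝓝 (-(x0 * y0))) := by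
    refine tl (hx'.sub (hx.mul hxp)) ?_ (by ring)
    filter_upwards [cob_le_cof h.ex] with t ht
    rw [ht]; ring
  have B : Tendsto (fun t => z t ^ 2 * (q t - p t) * t⁻¹) l (𝓝 (-1)) := by
    refine tl ((A.mul inv_cob).sub_const 1) ?_ (by simp)
    filter_upwards [t0] with t ht
    field_simp
    ring
  have Cc : Tendsto (fun t => t * deriv z t - z t ^ 2 * p t) l (𝓝 (-(x0 * y0))) := by
    refine tl A ?_ rfl
    filter_upwards [cob_le_cof h.ez] with t ht
    rw [ht]; ring
  have w_ne : ¬ ((fun t => q t - p t) =ᶠ[cofinite] fun _ => 0) := by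
    intro h0
    have : Tendsto (fun _ : ℂ => (0:ℂ)) l (𝓝 (-1)) := by
      refine tl B ?_ rfl
      filter_upwards [cob_le_cof h0] with t ht
      rw [ht]; ring
    have := P.uniq tendsto_const_nhds this
    norm_num at this
  obtain ⟨n, a, ha, hz, hz'⟩ := P.ex z h.rz h.z_ne
  obtain ⟨b, β, hβ, hw, hw'⟩ := P.ex _ (h.rq.sub h.rp) w_ne
  have hD : Tendsto (fun t => z t * (q t + p t)) l (𝓝 b) := by
    refine tl hw'.neg ?_ (by ring)
    filter_upwards [cob_le_cof h.ew, P.evne hβ hw] with t h1 h2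
    rw [h1]; field_simp
  have hord : b = -1 - 2 * n := by
    have h1 : Tendsto (fun t => (z t ^ 2 * (q t - p t) * t⁻¹) / t⁻¹ ^ (2 * n + b + 1)) l
        (𝓝 (a ^ 2 * β)) := by
      refine tl ((hz.pow 2).mul hw) ?_ rfl
      filter_upwards [t0] with t ht
      have ht' := inv_ne_zero ht
      rw [zpow_add₀ ht', zpow_add₀ ht', two_mul, zpow_add₀ ht', zpow_one]
      have := zpow_ne_zero n ht'
      have := zpow_ne_zero b ht'
      field_simp
    have h2 : Tendsto (fun t => (z t ^ 2 * (q t - p t) * t⁻¹) / t⁻¹ ^ (0 : ℤ)) l (𝓝 (-1)) := by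
      simpa using B
    have h3 := P.le_ord (mul_ne_zero (pow_ne_zero 2 ha) hβ) h1 h2
    have h4 := P.le_ord (by norm_num) h2 h1
    omega
  have zne := P.evne ha hz
  have wne := P.evne hβ hw
  have hn : n < 0 := by
    by_contra hn
    have h1 : Tendsto (fun t => z t * t⁻¹) l (𝓝 0) := by
      have := P.shift (-1) (by omega) hz
      simpa [div_eq_mul_inv] using this
    have h2 : Tendsto (fun t => z t ^ 2 * p t * t⁻¹) l (𝓝 0) := by
      refine tl ((hz'.mul h1).sub (Cc.mul inv_cob)) ?_ (by simp)
      filter_upwards [t0, zne] with t ht h3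
      field_simp
      ring
    have h3 := B.add (h2.const_mul 2)
    have h4 : Tendsto (fun t => z t ^ 2 * (q t - p t) * t⁻¹ + 2 * (z t ^ 2 * p t * t⁻¹)) l
        (𝓝 0) := by
      refine tl (hD.mul h1) ?_ (by simp)
      filter_upwards with t
      ring
    have := P.uniq h3 h4
    norm_num at this
  have hi := P.inv0 ha hn hz
  have hzp : Tendsto (fun t => z t * p t) l (𝓝 (-n)) := by
    refine tl (hz'.sub (Cc.mul hi)) ?_ (by simp)
    filter_upwards [zne] with t ht
    field_simp
    ring
  have hzw : Tendsto (fun t => z t * (q t - p t)) l (𝓝 (-1)) := by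
    refine tl (hD.sub (hzp.const_mul 2)) ?_ (by rw [hord]; push_cast; ring)
    filter_upwards with t
    ring
  have htz : Tendsto (fun t => t / z t) l (𝓝 1) := by
    refine tl (td hzw B (by norm_num)) ?_ (by norm_num)
    filter_upwards [zne, wne, t0] with t h1 h2 h3
    field_simp
  have hn1 : n = -1 := by
    have h1 : Tendsto (fun t => z t / t⁻¹ ^ (-1 : ℤ)) l (𝓝 1) := by
      refine tl (td (tendsto_const_nhds (x := (1:ℂ))) htz (by norm_num)) ?_ (by norm_num)
      filter_upwards [zne, t0] with t h1 h2
      simp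
    have h3 := P.le_ord ha hz h1
    have h4 := P.le_ord (by norm_num) h1 hz
    omega
  subst hn1
  norm_num at hord
  subst hord
  norm_num at hzp hD
  have hp0 : Tendsto p l (𝓝 0) := by
    refine tl (hzp.mul hi) ?_ (by simp)
    filter_upwards [zne] with t ht
    field_simp
  have hx0 : Tendsto x l (𝓝 0) := by
    rcases hric with ⟨k, -, a, -, -, -, h3⟩ | ⟨p0, x1, h2, h3, h4⟩
    · exact h3
    · have := P.uniq h2 hp0
      subst this
      simp at h4
      rwa [h4] at h3
  refine ⟨?_, w_ne, ?_, ?_⟩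
  · intro h0
    have : Tendsto (fun _ : ℂ => (0:ℂ)) l (𝓝 1) := by
      refine tl hzp ?_ rfl
      filter_upwards [cob_le_cof h0] with t ht
      rw [ht]; ring
    have := P.uniq tendsto_const_nhds this
    norm_num at this
  · intro h0
    refine P.noinv hi zne (tl hx0 ?_ rfl)
    filter_upwards [cob_le_cof h0] with t ht
    exact sub_eq_zero.mp ht
  · have h1 := (((hx0.pow 2).mul ((hp0.pow 2).sub_const 1)).add (hzw.mul hD)).div_const 4
    have h2 := ((((hzw.add hD).div_const 2).mul htz).div_const 2)
    refine tl (h1.add h2) ?_ (by norm_num)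
    filter_upwards [zne] with t ht
    simp only [KK]
    field_simp
    ring

end inf

section fin
variable {x p z q : ℂ → ℂ}

lemma Sol.epc (h : Sol x p z q) (c : ℂ) :
    ∀ᶠ t in 𝓝[≠] c, (t - c) * deriv p t = ((t - c) * x t / t) * (1 - p t ^ 2) := by
  filter_upwards [nhdsNE_le_cof c h.ep, nhdsNE_le_cof c (ev_ne 0)] with t h1 h2
  have : deriv p t = x t * (1 - p t ^ 2) / t := by
    rw [← h1]; field_simp
  rw [this]
  ring

lemma Sol.loc (h : Sol x p z q) (c : ℂ) : ∃ e b σ : ℤ, ∃ a β γ : ℂ, a ≠ 0 ∧ β ≠ 0 ∧ γ ≠ 0 ∧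
    Tendsto (fun t => z t / (t - c) ^ e) (𝓝[≠] c) (𝓝 a) ∧
    Tendsto (fun t => (q t - p t) / (t - c) ^ b) (𝓝[≠] c) (𝓝 β) ∧
    Tendsto (fun t => (x t - z t) / (t - c) ^ σ) (𝓝[≠] c) (𝓝 γ) ∧
    Tendsto (fun t => (t - c) * z t * q t / t + (t - c) / z t) (𝓝[≠] c) (𝓝 e) ∧
    Tendsto (fun t => (t - c) * z t * (q t + p t) / t) (𝓝[≠] c) (𝓝 (-b)) ∧
    Tendsto (fun t => (t - c) * (x t + z t) * p t / t) (𝓝[≠] c) (𝓝 σ) ∧ e ≤ 1 := by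
  obtain ⟨-, w_ne, u_ne, -⟩ := h.at_inf
  have P := place_fin c
  set l := 𝓝[≠] c
  obtain ⟨e, a, ha, hz, hz'⟩ := P.ex z h.rz h.z_ne
  obtain ⟨b, β, hβ, hw, hw'⟩ := P.ex _ (h.rq.sub h.rp) w_ne
  obtain ⟨σ, γ, hγ, hu, hu'⟩ := P.ex _ (h.rx.sub h.rz) u_ne
  have t0 : ∀ᶠ t : ℂ in l, t ≠ 0 := P.le (ev_ne 0)
  have zne := P.evne ha hz
  have H1 : Tendsto (fun t => (t - c) * z t * q t / t + (t - c) / z t) l (𝓝 e) := by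
    refine tl hz' ?_ (by ring)
    filter_upwards [P.le h.ez, zne, t0] with t h1 h2 h3
    have : deriv z t = (z t ^ 2 * q t + t) / t := by rw [← h1]; field_simp
    rw [this]; field_simp
  have H2 : Tendsto (fun t => (t - c) * z t * (q t + p t) / t) l (𝓝 (-b)) := by
    refine tl hw'.neg ?_ (by ring)
    filter_upwards [P.le h.ew, P.evne hβ hw, t0] with t h1 h2 h3
    have : deriv (fun t => q t - p t) t = -(z t * (q t + p t)) * (q t - p t) / t := by
      rw [← h1]; field_simp
    rw [this]; field_simp
  have H3 : Tendsto (fun t => (t - c) * (x t + z t) * p t / t) l (𝓝 σ) := by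
    refine tl hu' ?_ (by ring)
    filter_upwards [P.le h.eu, P.evne hγ hu, t0] with t h1 h2 h3
    have : deriv (fun t => x t - z t) t = (x t + z t) * p t * (x t - z t) / t := by
      rw [← h1]; field_simp
    rw [this]; field_simp
  refine ⟨e, b, σ, a, β, γ, ha, hβ, hγ, hz, hw, hu, H1, H2, H3, ?_⟩
  by_contra he
  have hzs : Tendsto (fun t => z t / (t - c)) l (𝓝 0) := by
    have := P.shift 1 (by omega) hz
    simpa using this
  obtain ⟨x0, y0, -, hxp⟩ := P.riccati_fin h.rp (h.p_ne 1 (by norm_num))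
    (h.p_ne (-1) (by norm_num)) (h.epc c)
  have h1 : Tendsto (fun t => z t ^ 2 * q t / t) l (𝓝 (-1)) := by
    refine tl ((H1.mul hzs).sub_const 1) ?_ (by simp)
    filter_upwards [zne, P.sne, t0] with t h1 h2 h3
    field_simp
    ring
  have h2 : Tendsto (fun t => z t ^ 2 * q t / t) l (𝓝 0) := by
    refine tl (((H2.mul hzs).sub (H3.mul hzs)).add (hxp.mul hzs)) ?_ (by simp)
    filter_upwards [zne, P.sne, t0] with t h1 h2 h3
    field_simp
    ring
  have := P.uniq h1 h2
  norm_num at this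

lemma Sol.q_pole (h : Sol x p z q) (c : ℂ) (hc : c ≠ 0) :
    ∃ N : ℕ, Tendsto (fun t => (t - c) ^ 2 * q t) (𝓝[≠] c) (𝓝 (-2 * c * N)) := by
  obtain ⟨e, b, σ, a, β, γ, ha, hβ, hγ, hz, hw, hu, H1, H2, H3, he⟩ := h.loc c
  have P := place_fin c
  set l := 𝓝[≠] c
  have t0 : ∀ᶠ t : ℂ in l, t ≠ 0 := P.le (ev_ne 0)
  have zne := P.evne ha hz
  have tc : Tendsto (fun t : ℂ => t) l (𝓝 c) := tendsto_id.mono_left nhdsWithin_le_nhds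
  rcases lt_or_eq_of_le he with he | rfl
  · have h1 : Tendsto (fun t => (t - c) / z t) l (𝓝 0) := by
      refine tl (td (P.spow (n := 1 - e) (by omega)) hz ha) ?_ (by simp)
      filter_upwards [P.sne, zne] with t h1 h2
      rw [zpow_sub₀ h1, zpow_one]
      have := zpow_ne_zero e h1
      field_simp
    refine ⟨0, tl (((H1.sub h1).mul h1).mul tc) ?_ (by simp)⟩
    filter_upwards [zne, t0] with t h1 h2
    field_simp
    ring
  · have hz1 : Tendsto (fun t => z t / (t - c)) l (𝓝 a) := by simpa using hz
    have hzi : Tendsto (fun t => (t - c) / z t) l (𝓝 (1 / a)) := by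
      refine tl (td (tendsto_const_nhds (x := (1:ℂ))) hz1 ha) ?_ rfl
      filter_upwards [zne, P.sne] with t h1 h2
      field_simp
    obtain ⟨r, hr⟩ : ∃ r : ℤ, 1 / a = r := by
      have hzp : Tendsto (fun t => (t - c) * z t * p t / t) l (𝓝 (-b - 1 + 1 / a)) := by
        refine tl ((H2.sub H1).add hzi) ?_ (by push_cast; ring)
        filter_upwards with t
        ring
      rcases P.riccati h.rp (h.p_ne 1 (by norm_num)) (h.p_ne (-1) (by norm_num)) (h.epc c) with
        ⟨k, hk, α, hα, -, h2, -⟩ | ⟨p0, x0, h2, -, -⟩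
      · have h3 : Tendsto (fun t => (t - c) * (x t + z t) * p t / t) l
            (𝓝 (k + (-b - 1 + 1 / a))) := by
          refine tl (h2.add hzp) ?_ (by ring)
          filter_upwards with t
          ring
        have h4 := P.uniq h3 H3
        refine ⟨σ + b + 1 - k, ?_⟩
        push_cast
        linear_combination h4
      · have h3 := td ((P.s0.mul (P.lim0 (by norm_num) hz)).mul h2) tc hc
        have h4 := P.uniq h3 hzp
        refine ⟨b + 1, ?_⟩
        push_cast
        simp only [zero_mul, zero_div] at h4
        linear_combination -h4
    rw [hr] at hzi
    obtain ⟨M, hM⟩ := Int.even_mul_pred_self r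
    have hM0 : 0 ≤ M := by
      have : 0 ≤ r * (r - 1) := by
        rcases le_or_gt r 0 with h1 | h1
        · nlinarith
        · nlinarith
      omega
    obtain ⟨N, rfl⟩ := Int.eq_ofNat_of_zero_le hM0
    have hM' : (r : ℂ) * (r - 1) = N + N := by exact_mod_cast hM
    refine ⟨N, tl (((H1.sub hzi).mul hzi).mul tc) ?_ ?_⟩
    · filter_upwards [zne, t0] with t h1 h2
      field_simp
      ring
    · push_cast
      linear_combination (-c) * hM'

lemma Sol.K_pole (h : Sol x p z q) (c : ℂ) (hc : c ≠ 0) :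
    ∃ N : ℕ, Tendsto (fun t => (t - c) * KK x p z q t) (𝓝[≠] c) (𝓝 (c * N)) := by
  obtain ⟨N, hN⟩ := h.q_pole c hc
  refine ⟨N, ?_⟩
  have P := place_fin c
  set l := 𝓝[≠] c
  have hK : Tendsto (fun t => (t - c) ^ 2 * deriv (KK x p z q) t) l (𝓝 (-c * N)) := by
    refine tl ((hN.add (P.s0.pow 2)).div_const 2) ?_ (by ring)
    filter_upwards [P.le h.eK] with t ht
    rw [ht]; ring
  rcases P.tri h.rK with ⟨k, hk, a, ha, h1, h2⟩ | ⟨p0, h1, h2⟩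
  · have h3 := h1.mul h2
    have hk1 : k = 1 := by
      by_contra hk1
      have h4 := hK.mul (P.spow (n := k - 1) (by omega))
      have h5 : Tendsto (fun t => (t - c) ^ 2 * deriv (KK x p z q) t * (t - c) ^ (k - 1)) l
          (𝓝 (a * (1 * (-k : ℤ)))) := by
        refine tl h3 ?_ rfl
        filter_upwards [P.sne, P.evne ha h1] with t ht h6
        rw [zpow_neg, zpow_sub₀ ht, zpow_one]
        have := zpow_ne_zero k ht
        field_simp
      have := P.uniq h4 h5
      simp [ha] at this
      omega
    subst hk1
    have h4 : Tendsto (fun t => (t - c) ^ 2 * deriv (KK x p z q) t) l (𝓝 (-a)) := by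
      refine tl h3 ?_ (by simp)
      filter_upwards [P.sne, P.evne ha h1] with t ht h6
      rw [zpow_neg, zpow_one]
      field_simp
    have h5 := P.uniq hK h4
    refine tl h1 ?_ (by linear_combination h5)
    filter_upwards [P.sne] with t ht
    rw [zpow_neg, zpow_one]
    field_simp
  · have h3 : Tendsto (fun t => (t - c) ^ 2 * deriv (KK x p z q) t) l (𝓝 0) := by
      refine tl (P.s0.mul h2) ?_ (by simp)
      filter_upwards with t
      ring
    have h4 := P.uniq hK h3
    refine tl (P.s0.mul h1) (Eventually.of_forall fun t => rfl) (by linear_combination h4)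

end fin

section zero
variable {x p z q : ℂ → ℂ}

lemma Sol.K_zero (h : Sol x p z q) : Tendsto (KK x p z q) (𝓝[≠] 0) (𝓝 0) := by
  obtain ⟨e, b, σ, a, β, γ, ha, hβ, hγ, hz, hw, hu, H1, H2, H3, he⟩ := h.loc 0
  have P := place_fin 0
  simp only [sub_zero] at hz hw hu H1 H2 H3 P
  set l := 𝓝[≠] (0 : ℂ)
  have t0 : ∀ᶠ t : ℂ in l, t ≠ 0 := P.le (ev_ne 0)
  have zne := P.evne ha hz
  have ht0 : Tendsto (fun t : ℂ => t) l (𝓝 0) := P.s0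
  have G1 : Tendsto (fun t => z t * q t + t / z t) l (𝓝 e) := by
    refine tl H1 ?_ rfl
    filter_upwards [t0] with t ht
    field_simp
  have G2 : Tendsto (fun t => z t * (q t + p t)) l (𝓝 (-b)) := by
    refine tl H2 ?_ rfl
    filter_upwards [t0] with t ht
    field_simp
  have G3 : Tendsto (fun t => x t * p t + z t * p t) l (𝓝 σ) := by
    refine tl H3 ?_ rfl
    filter_upwards [t0] with t ht
    field_simp
  have hric := P.riccati h.rp (h.p_ne 1 (by norm_num)) (h.p_ne (-1) (by norm_num)) (P.le h.ep)
  -- a general formula for the limit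
  have KF : ∀ A B C' D : ℂ, Tendsto (fun t => x t ^ 2 * (p t ^ 2 - 1)) l (𝓝 A) →
      Tendsto (fun t => z t * q t) l (𝓝 B) → Tendsto (fun t => z t * p t) l (𝓝 C') →
      Tendsto (fun t => t / z t) l (𝓝 D) → A + B ^ 2 - C' ^ 2 + 2 * B * D = 0 →
      Tendsto (KK x p z q) l (𝓝 0) := by
    intro A B C' D hA hB hC hD hs
    have h1 := ((((hA.add (hB.pow 2)).sub (hC.pow 2)).add ((hB.const_mul 2).mul hD)).div_const
      4).add (ht0.div_const 2)
    refine tl h1 ?_ (by rw [hs]; simp)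
    filter_upwards [zne] with t ht
    simp only [KK]
    field_simp
    ring
  rcases lt_or_eq_of_le he with he | rfl
  · have hzi : Tendsto (fun t => t / z t) l (𝓝 0) := by
      refine tl (td (P.spow (n := 1 - e) (by omega)) hz ha) ?_ (by simp)
      filter_upwards [t0, zne] with t h1 h2
      rw [zpow_sub₀ h1, zpow_one]
      have := zpow_ne_zero e h1
      field_simp
    have hzq : Tendsto (fun t => z t * q t) l (𝓝 e) := by
      refine tl (G1.sub hzi) ?_ (by simp)
      filter_upwards with t
      ring
    have hzp : Tendsto (fun t => z t * p t) l (𝓝 (-b - e)) := by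
      refine tl (G2.sub hzq) ?_ rfl
      filter_upwards with t
      ring
    rcases lt_or_eq_of_le (show e ≤ 0 by omega) with he | rfl
    · have hi := P.inv0 ha he hz
      rcases hric with ⟨k, hk, α, hα, h1, h2, h3⟩ | ⟨p0, x0, h1, h2, h3⟩
      · exfalso
        have h4 := P.inv0 hα (by omega) h1
        refine P.noinv (f := fun t => z t * p t) (tl (hi.mul h4) ?_ (by simp)) ?_ hzp
        · filter_upwards with t
          simp [mul_comm]
        · filter_upwards [zne, P.evne hα h1] with t h5 h6
          exact mul_ne_zero h5 h6
      · have hp0 : Tendsto p l (𝓝 0) := by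
          refine tl (hzp.mul hi) ?_ (by simp)
          filter_upwards [zne] with t ht
          field_simp
        have := P.uniq h1 hp0
        subst this
        simp at h3
        subst h3
        have hσ : σ = e := by
          have h4 : Tendsto (fun t => x t / t ^ (0 : ℤ)) l (𝓝 0) := by simpa using h2
          have h5 := P.shift e he h4
          have h6 : Tendsto (fun t => (x t - z t) / t ^ e) l (𝓝 (-a)) := by
            refine tl (h5.sub hz) ?_ (by ring)
            filter_upwards with t
            ring
          have h7 := P.le_ord hγ hu h6
          have h8 := P.le_ord (neg_ne_zero.mpr ha) h6 hu
          omega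
        subst hσ
        have h9 : Tendsto (fun t => z t * p t) l (𝓝 σ) := by
          refine tl (G3.sub (h2.mul h1)) ?_ (by ring)
          filter_upwards with t
          ring
        exact KF _ _ _ _ ((h2.pow 2).mul ((h1.pow 2).sub_const 1)) hzq h9 hzi (by ring)
    · simp only [zpow_zero, div_one] at hz
      rcases hric with ⟨k, hk, α, hα, h1, h2, h3⟩ | ⟨p0, x0, h1, h2, h3⟩
      · exfalso
        have h4 := P.inv0 hα (by omega) h1
        refine P.noinv h4 (P.evne hα h1) (tl (td hzp hz ha) ?_ rfl)
        filter_upwards [zne] with t ht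
        field_simp
      · have hq0 : Tendsto q l (𝓝 0) := by
          refine tl (td hzq hz ha) ?_ (by simp)
          filter_upwards [zne] with t ht
          field_simp
        have hp0 : p0 = 0 := by
          by_contra hp0
          have h4 : Tendsto (fun t => (q t - p t) / t ^ (0 : ℤ)) l (𝓝 (-p0)) := by
            simpa using hq0.sub h1
          have h7 := P.le_ord hβ hw h4
          have h8 := P.le_ord (neg_ne_zero.mpr hp0) h4 hw
          have hb : b = 0 := by omega
          have h9 := P.uniq G2 (hz.mul (hq0.add h1))
          rw [hb] at h9
          simp [ha] at h9
          exact hp0 h9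
        subst hp0
        exact KF _ _ _ _ ((h2.pow 2).mul ((h1.pow 2).sub_const 1)) hzq (hz.mul h1) hzi
          (by simp at h3; simp [h3])
  · have hz1 : Tendsto (fun t => z t / t) l (𝓝 a) := by simpa using hz
    have hzi : Tendsto (fun t => t / z t) l (𝓝 (1 / a)) := by
      refine tl (td (tendsto_const_nhds (x := (1:ℂ))) hz1 ha) ?_ rfl
      filter_upwards [zne, t0] with t h1 h2
      field_simp
    obtain ⟨r, hr⟩ : ∃ r, r = 1 / a := ⟨_, rfl⟩
    have har : a * r = 1 := by rw [hr]; field_simp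
    have hr0 : r ≠ 0 := by rintro rfl; simp at har
    rw [← hr] at hzi
    have hzq : Tendsto (fun t => z t * q t) l (𝓝 (1 - r)) := by
      refine tl (G1.sub hzi) ?_ (by simp)
      filter_upwards with t
      ring
    have hzp : Tendsto (fun t => z t * p t) l (𝓝 (r - b - 1)) := by
      refine tl (G2.sub hzq) ?_ (by ring)
      filter_upwards with t
      ring
    have hzw : Tendsto (fun t => z t * (q t - p t)) l (𝓝 (2 + b - 2 * r)) := by
      refine tl (hzq.sub hzp) ?_ (by ring)
      filter_upwards with t
      ring
    have hzw' : Tendsto (fun t => z t * (q t - p t) / t ^ (1 + b)) l (𝓝 (a * β)) := by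
      refine tl (hz.mul hw) ?_ rfl
      filter_upwards [t0] with t ht
      rw [zpow_add₀ ht]
      have := zpow_ne_zero b ht
      field_simp
    have hb1 : -1 ≤ b := by
      have := P.le_ord (k := 0) (mul_ne_zero ha hβ) hzw' (by simpa using hzw)
      omega
    have hb2 : b = -1 ∨ 2 + (b : ℂ) - 2 * r = 0 := by
      rcases lt_or_eq_of_le hb1 with h1 | h1
      · right
        exact P.uniq hzw (P.lim0 (by omega) hzw')
      · left; exact h1.symm
    rcases hric with ⟨k, hk, α, hα, h1, h2, h3⟩ | ⟨p0, x0, h1, h2, h3⟩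
    · have htp : Tendsto (fun t => p t / t ^ (-1 : ℤ)) l (𝓝 ((r - b - 1) * r)) := by
        refine tl (hzp.mul hzi) ?_ rfl
        filter_upwards [zne, t0] with t h4 h5
        rw [zpow_neg, zpow_one]
        field_simp
      have hk1 : k = 1 := by
        have := P.le_ord hα h1 htp
        omega
      subst hk1
      have hαe := P.uniq h1 htp
      have h2' : Tendsto (fun t => x t * p t) l (𝓝 1) := by simpa using h2
      have hxt : Tendsto (fun t => x t / t) l (𝓝 (1 / α)) := by
        refine tl (td h2' h1 hα) ?_ rfl
        filter_upwards [t0, P.evne hα h1] with t h4 h5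
        rw [zpow_neg, zpow_one]
        field_simp
      have hut : Tendsto (fun t => (x t - z t) / t ^ (1 : ℤ)) l (𝓝 (1 / α - a)) := by
        refine tl (hxt.sub hz1) ?_ rfl
        filter_upwards with t
        rw [zpow_one]; ring
      have hσ := P.uniq G3 (h2'.add hzp)
      have hσ1 := P.le_ord hγ hu hut
      have hσ2 : 1 < σ := by
        rcases lt_or_eq_of_le hσ1 with h4 | h4
        · exact h4
        · exfalso
          rw [← h4] at hσ
          apply hα
          rw [hαe]
          push_cast at hσ
          linear_combination -r * hσ
      have h5 := P.uniq hut (P.shift 1 hσ2 hu)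
      have h6 : α = r := by
        field_simp at h5
        linear_combination (-r) * h5 - α * har
      have h7 : r = b + 2 := by
        have : r * (r - b - 2) = 0 := by linear_combination h6 - hαe
        rcases mul_eq_zero.mp this with h8 | h8
        · exact (hr0 h8).elim
        · linear_combination h8
      have hb : b = -1 := by
        rcases hb2 with h8 | h8
        · exact h8
        · exfalso
          rw [h7] at h8
          have : (b : ℂ) = ((-2 : ℤ) : ℂ) := by push_cast; linear_combination -h8
          have := Int.cast_injective this
          omega
      subst hb
      have hA : Tendsto (fun t => x t ^ 2 * (p t ^ 2 - 1)) l (𝓝 1) := by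
        refine tl ((h2'.pow 2).sub (h3.pow 2)) ?_ (by norm_num)
        filter_upwards with t
        ring
      refine KF _ _ _ _ hA hzq hzp hzi ?_
      rw [h7]; norm_num
    · have h4 := P.uniq hzp ((P.lim0 (by norm_num) hz).mul h1)
      have h5 : r = b + 1 := by linear_combination h4
      have hb : b = 0 := by
        rcases hb2 with h6 | h6
        · exfalso
          apply hr0
          rw [h5, h6]; norm_num
        · rw [h5] at h6
          have : (b : ℂ) = ((0 : ℤ) : ℂ) := by push_cast; linear_combination -h6
          exact Int.cast_injective this
      subst hb
      refine KF _ _ _ _ ((h2.pow 2).mul ((h1.pow 2).sub_const 1)) hzq hzp hzi ?_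
      rw [h5]
      push_cast
      linear_combination -x0 * h3

end zero

/-! ### The global argument -/

lemma poly_ne_lim (f : ℂ[X]) (c : ℂ) : Tendsto (fun t => f.eval t) (𝓝[≠] c) (𝓝 (f.eval c)) :=
  (f.continuous.tendsto c).mono_left nhdsWithin_le_nhds

lemma poly_bdd {R : ℂ[X]} {L : ℂ}
    (h : Tendsto (fun t => R.eval t) (Bornology.cobounded ℂ) (𝓝 L)) : R = C L := by
  have P := place_inf
  have hd : R.natDegree = 0 := by
    by_contra hn
    have h1 := poly_cob R R.natDegree le_rfl
    have h2 := h.mul (P.spow (n := R.natDegree) (by omega))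
    have h3 : Tendsto (fun t => R.eval t * (t⁻¹) ^ (R.natDegree : ℤ)) (Bornology.cobounded ℂ)
        (𝓝 (R.coeff R.natDegree)) := by
      refine tl h1 ?_ rfl
      filter_upwards with t
      simp [div_eq_mul_inv]
    have h4 := P.uniq h2 h3
    rw [mul_zero, coeff_natDegree] at h4
    have := leadingCoeff_eq_zero.mp h4.symm
    simp [this] at hn
  rw [eq_C_of_natDegree_eq_zero hd] at h ⊢
  simp only [eval_C] at h
  rw [P.uniq tendsto_const_nhds h]

lemma glob (d : ℕ) : ∀ P Q : ℂ[X], Q.natDegree = d → Q ≠ 0 →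
    (∀ c : ℂ, c ≠ 0 → ∃ N : ℕ, Tendsto (fun t => (t - c) * (P.eval t / Q.eval t)) (𝓝[≠] c)
      (𝓝 (c * N))) →
    Tendsto (fun t => P.eval t / Q.eval t) (𝓝[≠] 0) (𝓝 0) →
    ∀ L : ℂ, Tendsto (fun t => P.eval t / Q.eval t - t / 2) (Bornology.cobounded ℂ) (𝓝 L) →
    ∃ M : ℕ, L = M := by
  induction d with
  | zero =>
    intro P Q hd hQ _ h0 L hL
    obtain ⟨k, rfl⟩ : ∃ k, Q = C k := ⟨_, eq_C_of_natDegree_eq_zero hd⟩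
    have hR := poly_bdd (R := C k⁻¹ * P - C (1/2) * X) (L := L) (by
      refine tl hL ?_ rfl
      filter_upwards with t
      simp only [eval_sub, eval_mul, eval_C, eval_X]
      ring)
    refine ⟨0, ?_⟩
    have h1 := poly_ne_lim (C k⁻¹ * P) 0
    have h2 : Tendsto (fun t => (C k⁻¹ * P).eval t) (𝓝[≠] 0) (𝓝 0) := by
      refine tl h0 ?_ rfl
      filter_upwards with t
      simp only [eval_mul, eval_C]
      ring
    have h3 := (place_fin 0).uniq h1 h2
    have h4 := congrArg (eval 0) hR
    rw [eval_sub, h3] at h4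
    simp at h4
    simp [← h4]
  | succ d ih =>
    intro P Q hd hQ hc h0 L hL
    obtain ⟨c, hcr⟩ := IsAlgClosed.exists_root Q (by
      rw [degree_eq_natDegree hQ, hd]
      exact_mod_cast Nat.succ_ne_zero d)
    obtain ⟨Q1, rfl⟩ := dvd_iff_isRoot.mpr hcr
    have hQ1 : Q1 ≠ 0 := right_ne_zero_of_mul hQ
    have hd1 : Q1.natDegree = d := by
      rw [natDegree_mul (X_sub_C_ne_zero c) hQ1, natDegree_X_sub_C] at hd
      omega
    have evQ1 := ev_poly_ne hQ1
    by_cases hPc : P.eval c = 0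
    · obtain ⟨P1, rfl⟩ := dvd_iff_isRoot.mpr hPc
      have e : ∀ᶠ t in cofinite, eval t ((X - C c) * P1) / eval t ((X - C c) * Q1) =
          eval t P1 / eval t Q1 := by
        filter_upwards [ev_ne c] with t ht
        simp only [eval_mul, eval_sub, eval_X, eval_C]
        rw [mul_div_mul_left _ _ (sub_ne_zero.mpr ht)]
      refine ih P1 Q1 hd1 hQ1 ?_ ?_ L ?_
      · intro c' hc'
        obtain ⟨N, hN⟩ := hc c' hc'
        refine ⟨N, tl hN ?_ rfl⟩
        filter_upwards [nhdsNE_le_cof c' e] with t ht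
        rw [ht]
      · refine tl h0 ?_ rfl
        filter_upwards [nhdsNE_le_cof 0 e] with t ht
        rw [ht]
      · refine tl hL ?_ rfl
        filter_upwards [cob_le_cof e] with t ht
        rw [ht]
    · have hc0 : c ≠ 0 := by
        rintro rfl
        apply hPc
        refine (place_fin 0).uniq (poly_ne_lim P 0)
          (tl (h0.mul (poly_ne_lim ((X - C 0) * Q1) 0)) ?_ (by simp))
        filter_upwards [nhdsNE_le_cof 0 (ev_poly_ne hQ)] with t ht
        field_simp
      obtain ⟨N, hN⟩ := hc c hc0
      have hPN : P.eval c = c * N * Q1.eval c := by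
        refine (place_fin c).uniq (poly_ne_lim P c) (tl (hN.mul (poly_ne_lim Q1 c)) ?_ rfl)
        filter_upwards [nhdsNE_le_cof c evQ1, nhdsNE_le_cof c (ev_ne c)] with t h1 h2
        have := sub_ne_zero.mpr h2
        simp only [eval_mul, eval_sub, eval_X, eval_C]
        field_simp
      have hQ1c : Q1.eval c ≠ 0 := by
        intro h; apply hPc; rw [hPN, h]; ring
      obtain ⟨P2, hP2⟩ : (X - C c) ∣ P - C (N : ℂ) * X * Q1 := by
        rw [dvd_iff_isRoot, IsRoot.def]
        simp only [eval_mul, eval_sub, eval_X, eval_C]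
        rw [hPN]; ring
      have e : ∀ᶠ t in cofinite, eval t P2 / eval t Q1 =
          eval t P / eval t ((X - C c) * Q1) - N * (t / (t - c)) := by
        filter_upwards [ev_ne c, evQ1] with t h1 h2
        have h3 := sub_ne_zero.mpr h1
        have h4 := congrArg (eval t) hP2
        simp only [eval_mul, eval_sub, eval_X, eval_C] at h4 ⊢
        field_simp
        linear_combination -h4
      obtain ⟨M, hM⟩ := ih P2 Q1 hd1 hQ1 (by
        intro c' hc'
        by_cases hcc : c' = c
        · subst hcc
          refine ⟨0, tl ((place_fin c').s0.mul (td (poly_ne_lim P2 c') (poly_ne_lim Q1 c') hQ1c))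
            (Eventually.of_forall fun t => rfl) (by simp)⟩
        · obtain ⟨N', hN'⟩ := hc c' hc'
          have tc : Tendsto (fun t : ℂ => t) (𝓝[≠] c') (𝓝 c') :=
            tendsto_id.mono_left nhdsWithin_le_nhds
          refine ⟨N', tl (hN'.sub ((place_fin c').s0.mul
            ((td tc (tc.sub_const c) (sub_ne_zero.mpr hcc)).const_mul (N : ℂ)))) ?_ (by simp)⟩
          filter_upwards [nhdsNE_le_cof c' e] with t ht
          rw [ht]; ring) (by
        have tc : Tendsto (fun t : ℂ => t) (𝓝[≠] 0) (𝓝 0) :=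
            tendsto_id.mono_left nhdsWithin_le_nhds
        refine tl (h0.sub ((td tc (tc.sub_const c) (sub_ne_zero.mpr hc0.symm)).const_mul (N : ℂ)))
          ?_ (by simp)
        filter_upwards [nhdsNE_le_cof 0 e] with t ht
        rw [ht]) (L - N) (by
        have h1 : Tendsto (fun t : ℂ => t / (t - c)) (Bornology.cobounded ℂ) (𝓝 1) := by
          refine tl (td (tendsto_const_nhds (x := (1:ℂ))) ((inv_cob.const_mul c).const_sub 1)
            (by simp)) ?_ (by simp)
          filter_upwards [cob_le_cof (ev_ne 0), cob_le_cof (ev_ne c)] with t h2 h3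
          have h4 := sub_ne_zero.mpr h3
          have : 1 - c * t⁻¹ = (t - c) / t := by field_simp
          rw [this]
          field_simp
        refine tl (hL.sub (h1.const_mul (N : ℂ))) ?_ (by simp)
        filter_upwards [cob_le_cof e] with t ht
        rw [ht]; ring)
      exact ⟨M + N, by push_cast; linear_combination hM⟩

lemma Sol.false {x p z q : ℂ → ℂ} (h : Sol x p z q) : False := by
  obtain ⟨P, Q, hQ, e⟩ := h.rK
  obtain ⟨M, hM⟩ := glob _ P Q rfl hQ (by
    intro c hc
    obtain ⟨N, hN⟩ := h.K_pole c hc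
    refine ⟨N, tl hN ?_ rfl⟩
    filter_upwards [nhdsNE_le_cof c e] with t ht
    rw [ht]) (by
    refine tl h.K_zero ?_ rfl
    filter_upwards [nhdsNE_le_cof 0 e] with t ht
    rw [ht]) (-1/4) (by
    refine tl h.at_inf.2.2.2 ?_ rfl
    filter_upwards [cob_le_cof e] with t ht
    rw [ht])
  have h1 : ((4 * M + 1 : ℕ) : ℂ) = 0 := by push_cast; linear_combination -4 * hM
  rw [Nat.cast_eq_zero] at h1
  omega

/-- The Sasano system `B₄⁽¹⁾(0, 0, 0, 0, 1/2)` has no rational solution. -/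
theorem B4_no_rational_solution_at_special_parameters :
    ¬ ∃ x y z w : ℂ → ℂ, IsRatSolB4 0 0 0 0 (1/2) x y z w := by
  rintro ⟨x, y, z, w, hx, hy, hz, hw, S, hS, hE⟩
  have rx := RatAE.of_isRatFn hx
  have ry := RatAE.of_isRatFn hy
  have rz := RatAE.of_isRatFn hz
  have rw' := RatAE.of_isRatFn hw
  have E : ∀ᶠ t in cofinite, B4Eqs 0 0 0 0 (1/2) x y z w t := by
    filter_upwards [hS.eventually_cofinite_notMem] with t ht
    exact hE t ht
  have rp : RatAE (fun t => 2 * y t - 1) := ((RatAE.const 2).mul ry).sub (RatAE.const 1)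
  have rq : RatAE (fun t => 2 * w t + (2 * y t - 1)) := ((RatAE.const 2).mul rw').add rp
  have dp : ∀ᶠ t in cofinite, deriv (fun t => 2 * y t - 1) t = 2 * deriv y t := by
    filter_upwards [ry.diff] with t ht
    exact ((ht.hasDerivAt.const_mul 2).sub_const 1).deriv
  have dq : ∀ᶠ t in cofinite, deriv (fun t => 2 * w t + (2 * y t - 1)) t =
      2 * deriv w t + 2 * deriv y t := by
    filter_upwards [ry.diff, rw'.diff] with t ht ht'
    exact ((ht'.hasDerivAt.const_mul 2).fun_add ((ht.hasDerivAt.const_mul 2).sub_const 1)).deriv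
  refine Sol.false (x := x) (p := fun t => 2 * y t - 1) (z := z)
    (q := fun t => 2 * w t + (2 * y t - 1)) ⟨rx, rp, rz, rq, ?_, ?_, ?_, ?_⟩
  · filter_upwards [E] with t ⟨h1, h2, h3, h4⟩
    rw [h1]; ring
  · filter_upwards [E, dp] with t ⟨h1, h2, h3, h4⟩ h5
    rw [h5]; linear_combination 2 * h2
  · filter_upwards [E] with t ⟨h1, h2, h3, h4⟩
    rw [h3]; ring
  · filter_upwards [E, dq] with t ⟨h1, h2, h3, h4⟩ h5
    rw [h5]; linear_combination 2 * h2 + 2 * h4
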